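/- Let (G, H) be a mixed graph on a nonempty finite vertex type with at least one edge, and let Q = D + H be its γ-signless Laplacian adjacency matrix with largest eigenvalue λ₁. Then max_{u ∈ V} deg(u) ≤ λ₁ ≤ max over edges {u,v} of G of (deg(u) + deg(v)). -/

import Mathlib

open Matrix Complex BigOperators

noncomputable def gamma : ℂ := Complex.exp (2 * Real.pi * Complex.I / 3)

lemma norm_gamma : ‖gamma‖ = 1 := by
  have h : (2 * Real.pi * Complex.I / 3 : ℂ) = ((2 * Real.pi / 3 : ℝ) : ℂ) * Complex.I := by
    push_cast
    ring
  rw [gamma, h, Complex.norm_exp_ofReal_mul_I]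

/-- A diagonal entry of a Hermitian matrix is at most the largest eigenvalue. -/
lemma Matrix.IsHermitian.re_diag_le_iSup_eigenvalues {n : Type*} [Fintype n] [DecidableEq n]
    {A : Matrix n n ℂ} (hA : A.IsHermitian) (u : n) :
    (A u u).re ≤ ⨆ i, hA.eigenvalues i := by
  set U : Matrix n n ℂ := (hA.eigenvectorUnitary : Matrix n n ℂ) with hU
  have hdiag : A u u = ((∑ i, hA.eigenvalues i * ‖U u i‖ ^ 2 : ℝ) : ℂ) := by
    conv_lhs => rw [hA.spectral_theorem, Unitary.conjStarAlgAut_apply]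
    rw [Matrix.mul_apply]
    push_cast
    refine Finset.sum_congr rfl fun i _ => ?_
    rw [Matrix.mul_diagonal, Matrix.star_apply, ← hU, ← Complex.mul_conj']
    simp
    ring
  have hrow : ∑ i, ‖U u i‖ ^ 2 = 1 := by
    have h : (U * star U) u u = 1 := by
      rw [hU, Unitary.mul_star_self_of_mem hA.eigenvectorUnitary.2, Matrix.one_apply_eq]
    rw [Matrix.mul_apply] at h
    have h' : ((∑ i, ‖U u i‖ ^ 2 : ℝ) : ℂ) = 1 := by
      rw [← h]
      push_cast
      refine Finset.sum_congr rfl fun i _ => ?_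
      rw [Matrix.star_apply, ← Complex.mul_conj']
      rfl
    exact_mod_cast h'
  rw [hdiag, Complex.ofReal_re]
  calc ∑ i, hA.eigenvalues i * ‖U u i‖ ^ 2
      ≤ ∑ i, (⨆ j, hA.eigenvalues j) * ‖U u i‖ ^ 2 := by
        gcongr with i
        exact le_ciSup (Finite.bddAbove_range _) i
    _ = ⨆ j, hA.eigenvalues j := by rw [← Finset.mul_sum, hrow, mul_one]

/-- If `H` is supported on the edges of `G` with entries of modulus at most one, any nonnegative
bound on `deg u + deg v` over the edges bounds every real eigenvalue of `D + H`. -/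
lemma eigenvalue_le_of_degree_add_degree_le {V : Type*} [Fintype V] [DecidableEq V] [Nonempty V]
    (G : SimpleGraph V) [DecidableRel G.Adj] (H : Matrix V V ℂ)
    (hnorm : ∀ u v, G.Adj u v → ‖H u v‖ ≤ 1) (hnadj : ∀ u v, ¬ G.Adj u v → H u v = 0)
    {b : ℝ} (hb : 0 ≤ b) (hdeg : ∀ u v, G.Adj u v → (G.degree u + G.degree v : ℝ) ≤ b)
    {μ : ℝ} {x : V → ℂ} (hx : x ≠ 0)
    (heig : (Matrix.diagonal (fun u => (G.degree u : ℂ)) + H) *ᵥ x = (μ : ℂ) • x) :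
    μ ≤ b := by
  have hrow (u : V) : μ * ‖x u‖ ≤ G.degree u * ‖x u‖ + ∑ v ∈ G.neighborFinset u, ‖x v‖ := by
    have h : (μ : ℂ) * x u = G.degree u * x u + ∑ v ∈ G.neighborFinset u, H u v * x v := by
      have h := congrFun heig u
      rw [Matrix.add_mulVec, Pi.add_apply, Matrix.mulVec_diagonal, Pi.smul_apply,
        smul_eq_mul] at h
      rw [← h, Matrix.mulVec, dotProduct]
      congr 1
      symm
      refine Finset.sum_subset (Finset.subset_univ _) fun v _ hv => ?_
      rw [hnadj u v (by simpa using hv), zero_mul]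
    calc μ * ‖x u‖ ≤ |μ| * ‖x u‖ := by gcongr; exact le_abs_self μ
      _ = ‖(μ : ℂ) * x u‖ := by rw [norm_mul, Complex.norm_real, Real.norm_eq_abs]
      _ ≤ ‖(G.degree u : ℂ) * x u‖ + ‖∑ v ∈ G.neighborFinset u, H u v * x v‖ := by
        rw [h]; exact norm_add_le _ _
      _ ≤ _ := by
        rw [norm_mul, Complex.norm_natCast]
        gcongr
        refine (norm_sum_le _ _).trans (Finset.sum_le_sum fun v hv => ?_)
        rw [norm_mul]
        exact mul_le_of_le_one_left (norm_nonneg _) (hnorm u v (by simpa using hv))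
  obtain ⟨u, hu⟩ := Finite.exists_max fun v => ‖x v‖ / G.degree v
  set M := ‖x u‖ / G.degree u with hM
  have hdeg_pos {v w : V} (h : G.Adj v w) : (0 : ℝ) < G.degree w := by
    exact_mod_cast (G.degree_pos_iff_exists_adj w).2 ⟨v, h.symm⟩
  have hle {v w : V} (h : G.Adj v w) : ‖x w‖ ≤ M * G.degree w :=
    (div_le_iff₀ (hdeg_pos h)).1 (hu w)
  have hM0 : 0 ≤ M := by positivity
  rcases hM0.eq_or_lt with hM0 | hMpos
  · obtain ⟨w, hw⟩ := Function.ne_iff.1 hx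
    have hw' : 0 < ‖x w‖ := norm_pos_iff.2 hw
    have hiso (v : V) : ¬ G.Adj v w := fun h => by
      have := hle h
      rw [← hM0, zero_mul] at this
      exact this.not_gt hw'
    have hempty : G.neighborFinset w = ∅ := by
      ext v
      simpa using fun h : G.Adj w v => hiso v h.symm
    have h := hrow w
    rw [← G.card_neighborFinset_eq_degree, hempty] at h
    simp only [Finset.card_empty, Nat.cast_zero, zero_mul, Finset.sum_empty, add_zero] at h
    exact (nonpos_of_mul_nonpos_left h hw').trans hb
  · have hd : (0 : ℝ) < G.degree u := by
      refine (Nat.cast_nonneg _).lt_of_ne fun h => hMpos.ne' ?_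
      rw [hM, ← h, div_zero]
    have hxu : ‖x u‖ = M * G.degree u := by rw [hM, div_mul_cancel₀ _ hd.ne']
    have key : μ * (M * G.degree u) ≤ b * (M * G.degree u) :=
      calc μ * (M * G.degree u)
          ≤ G.degree u * (M * G.degree u) + ∑ v ∈ G.neighborFinset u, ‖x v‖ := hxu ▸ hrow u
        _ ≤ G.degree u * (M * G.degree u) + ∑ v ∈ G.neighborFinset u, M * G.degree v := by
          gcongr with v hv
          exact hle (by simpa using hv)
        _ = ∑ v ∈ G.neighborFinset u, M * (G.degree u + G.degree v) := by
          simp only [mul_add, Finset.sum_add_distrib, Finset.sum_const,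
            G.card_neighborFinset_eq_degree, nsmul_eq_mul]
        _ ≤ ∑ v ∈ G.neighborFinset u, M * b := by
          gcongr with v hv
          exact hdeg u v (by simpa using hv)
        _ = b * (M * G.degree u) := by
          rw [Finset.sum_const, G.card_neighborFinset_eq_degree, nsmul_eq_mul]
          ring
    exact le_of_mul_le_mul_right key (by positivity)

/-- For the γ-signless Laplacian `Q = D + H` of a mixed graph with at least one edge,
the largest eigenvalue `λ₁` satisfies
`max deg(u) ≤ λ₁ ≤ max over edges {u,v} of (deg u + deg v)`. -/
theorem signless_laplacian_largest_eigenvalue_bounds {V : Type*} [Fintype V] [DecidableEq V]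
    [Nonempty V] (G : SimpleGraph V) [DecidableRel G.Adj]
    (hE : G.edgeFinset.Nonempty)
    (H : Matrix V V ℂ) (hH : H.IsHermitian)
    (hadj : ∀ u v, G.Adj u v → H u v ∈ ({1, gamma, gamma ^ 2} : Set ℂ))
    (hnadj : ∀ u v, ¬ G.Adj u v → H u v = 0)
    (hQ : (Matrix.diagonal (fun u => (G.degree u : ℂ)) + H).IsHermitian) :
    ((Finset.univ.sup fun u => G.degree u : ℕ) : ℝ) ≤ (⨆ i, hQ.eigenvalues i) ∧
      (⨆ i, hQ.eigenvalues i) ≤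
        ((G.edgeFinset.sup
            (Sym2.lift ⟨fun u v => G.degree u + G.degree v, fun u v => by ring⟩) : ℕ) : ℝ) := by
  refine ⟨?_, ciSup_le fun i => ?_⟩
  · obtain ⟨u, -, hu⟩ := Finset.exists_mem_eq_sup Finset.univ Finset.univ_nonempty
      fun u => G.degree u
    rw [hu]
    simpa [hnadj u u (G.loopless.irrefl u)] using hQ.re_diag_le_iSup_eigenvalues u
  · refine eigenvalue_le_of_degree_add_degree_le G H (fun u v h => ?_) hnadj (Nat.cast_nonneg _)
      (fun u v h => ?_) (x := ⇑(hQ.eigenvectorBasis i)) (fun h => ?_) ?_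
    · rcases hadj u v h with h | h | h
      · rw [h, norm_one]
      · rw [h, norm_gamma]
      · rw [Set.mem_singleton_iff.1 h, norm_pow, norm_gamma, one_pow]
    · exact_mod_cast Finset.le_sup (f := Sym2.lift ⟨fun u v => G.degree u + G.degree v, _⟩)
        (SimpleGraph.mem_edgeFinset.2 h : s(u, v) ∈ G.edgeFinset)
    · exact hQ.eigenvectorBasis.orthonormal.ne_zero i (by ext v; exact congrFun h v)
    · rw [hQ.mulVec_eigenvectorBasis i]
      ext v
      simp
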